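/- Let d ≥ 1, L ≥ 2, Φ ∈ ℝ^{d×d}, and set φ = max{2‖Φ‖_F, 3 L^{−1/2}, 1}. Let W_1(t),…,W_L(t) evolve by discrete gradient descent W_l(t+1) = W_l(t) − η ∇_l R(t) from the zero-asymmetric initialization W_l(0) = I (l = 1,…,L−1), W_L(0) = 0. If the learning rate satisfies η ≤ min{(4 L³ φ⁶)^{−1}, (144 L² φ⁴)^{−1}}, then R(t) ≤ (1 − η/2)^t R(0) for all t = 0, 1, 2, …. -/

import Mathlib

open Matrix

namespace ZAS

/-- `seg W l₁ l₂ = W l₂ * W (l₂-1) * ⋯ * W l₁` (the empty product, when `l₂ < l₁`, is `1`). -/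
noncomputable def seg {d : ℕ} (W : ℕ → Matrix (Fin d) (Fin d) ℝ) (l₁ : ℕ) :
    ℕ → Matrix (Fin d) (Fin d) ℝ
  | 0 => 1
  | (k+1) => if k + 1 < l₁ then 1 else W (k+1) * seg W l₁ k

/-- Squared Frobenius norm `‖A‖_F²`. -/
noncomputable def frobSq {m n : ℕ} (A : Matrix (Fin m) (Fin n) ℝ) : ℝ :=
  ∑ i, ∑ j, (A i j)^2

/-- Frobenius norm `‖A‖_F`. -/
noncomputable def frob {m n : ℕ} (A : Matrix (Fin m) (Fin n) ℝ) : ℝ :=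
  Real.sqrt (frobSq A)

/-- Frobenius inner product `⟨A, B⟩ = tr(Aᵀ B)`. -/
noncomputable def finner {m n : ℕ} (A B : Matrix (Fin m) (Fin n) ℝ) : ℝ :=
  ∑ i, ∑ j, A i j * B i j

/-- The loss `R(W_1, …, W_L) = (1/2) ‖W_{L:1} - Φ‖_F²`. -/
noncomputable def loss {d : ℕ} (W : ℕ → Matrix (Fin d) (Fin d) ℝ)
    (Φ : Matrix (Fin d) (Fin d) ℝ) (L : ℕ) : ℝ :=
  frobSq (seg W 1 L - Φ) / 2

/-- The gradient `∇_l R = W_{L:l+1}ᵀ (W_{L:1} - Φ) W_{l-1:1}ᵀ`. -/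
noncomputable def grad {d : ℕ} (W : ℕ → Matrix (Fin d) (Fin d) ℝ)
    (Φ : Matrix (Fin d) (Fin d) ℝ) (L l : ℕ) : Matrix (Fin d) (Fin d) ℝ :=
  (seg W (l+1) L)ᵀ * (seg W 1 L - Φ) * (seg W 1 (l-1))ᵀ

/-- The invariant matrices `D_l = W_{l+1}ᵀ W_{l+1} - W_l W_lᵀ`. -/
noncomputable def Dmat {d : ℕ} (W : ℕ → Matrix (Fin d) (Fin d) ℝ) (l : ℕ) :
    Matrix (Fin d) (Fin d) ℝ :=
  (W (l+1))ᵀ * W (l+1) - W l * (W l)ᵀ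

/-- Spectral norm (operator 2-norm) of a square real matrix. -/
noncomputable def spec {d : ℕ} (A : Matrix (Fin d) (Fin d) ℝ) : ℝ :=
  ‖Matrix.toEuclideanCLM (𝕜 := ℝ) A‖

/-- The loss on data: `R̃ = (1/2) ‖W_{L:1} X - Y‖_F²`. -/
noncomputable def lossT {d n : ℕ} (W : ℕ → Matrix (Fin d) (Fin d) ℝ)
    (X Y : Matrix (Fin d) (Fin n) ℝ) (L : ℕ) : ℝ :=
  frobSq (seg W 1 L * X - Y) / 2

/-- The gradient of the data loss: `∇_l R̃ = W_{L:l+1}ᵀ (W_{L:1} X - Y) Xᵀ W_{l-1:1}ᵀ`. -/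
noncomputable def gradT {d n : ℕ} (W : ℕ → Matrix (Fin d) (Fin d) ℝ)
    (X Y : Matrix (Fin d) (Fin n) ℝ) (L l : ℕ) : Matrix (Fin d) (Fin d) ℝ :=
  (seg W (l+1) L)ᵀ * (seg W 1 L * X - Y) * Xᵀ * (seg W 1 (l-1))ᵀ

end ZAS

namespace ZAS

variable {d : ℕ}

theorem frobSq_nonneg (A : Matrix (Fin d) (Fin d) ℝ) : 0 ≤ frobSq A :=
  Finset.sum_nonneg fun _ _ => Finset.sum_nonneg fun _ _ => sq_nonneg _

theorem frob_nonneg (A : Matrix (Fin d) (Fin d) ℝ) : 0 ≤ frob A := Real.sqrt_nonneg _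

theorem frob_sq (A : Matrix (Fin d) (Fin d) ℝ) : frob A ^ 2 = frobSq A :=
  Real.sq_sqrt (frobSq_nonneg A)

theorem finner_self (A : Matrix (Fin d) (Fin d) ℝ) : finner A A = frobSq A := by
  simp only [finner, frobSq, sq]

theorem finner_eq_trace (A B : Matrix (Fin d) (Fin d) ℝ) : finner A B = (Aᵀ * B).trace := by
  simp only [finner, trace, diag, mul_apply, transpose_apply]
  exact Finset.sum_comm

theorem finner_comm (A B : Matrix (Fin d) (Fin d) ℝ) : finner A B = finner B A := by
  simp only [finner, mul_comm]

theorem finner_add_right (A B C : Matrix (Fin d) (Fin d) ℝ) :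
    finner A (B + C) = finner A B + finner A C := by
  simp only [finner_eq_trace, Matrix.mul_add, trace_add]

theorem finner_smul_right (A B : Matrix (Fin d) (Fin d) ℝ) (c : ℝ) :
    finner A (c • B) = c * finner A B := by
  simp only [finner_eq_trace, Matrix.mul_smul, trace_smul, smul_eq_mul]

theorem finner_mul_left (A X Y : Matrix (Fin d) (Fin d) ℝ) :
    finner (A * X) Y = finner X (Aᵀ * Y) := by
  simp only [finner_eq_trace, transpose_mul, Matrix.mul_assoc]

theorem finner_mul_right (A X Y : Matrix (Fin d) (Fin d) ℝ) :
    finner (X * A) Y = finner X (Y * Aᵀ) := by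
  simp only [finner_eq_trace, transpose_mul]
  rw [Matrix.mul_assoc, trace_mul_comm, Matrix.mul_assoc]

theorem frobSq_add (A B : Matrix (Fin d) (Fin d) ℝ) :
    frobSq (A + B) = frobSq A + 2 * finner A B + frobSq B := by
  simp only [frobSq, finner, Finset.mul_sum, ← Finset.sum_add_distrib, Matrix.add_apply]
  exact Finset.sum_congr rfl fun _ _ => Finset.sum_congr rfl fun _ _ => by ring

theorem frobSq_smul (c : ℝ) (A : Matrix (Fin d) (Fin d) ℝ) :
    frobSq (c • A) = c ^ 2 * frobSq A := by
  simp only [frobSq, Finset.mul_sum, Matrix.smul_apply, smul_eq_mul, mul_pow]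

theorem frobSq_sub_smul (A B : Matrix (Fin d) (Fin d) ℝ) (c : ℝ) :
    frobSq (A - c • B) = frobSq A - 2 * c * finner A B + c ^ 2 * frobSq B := by
  rw [sub_eq_add_neg, ← neg_smul, frobSq_add, finner_smul_right, frobSq_smul]
  ring

theorem frobSq_transpose (A : Matrix (Fin d) (Fin d) ℝ) : frobSq Aᵀ = frobSq A :=
  Finset.sum_comm

theorem frob_transpose (A : Matrix (Fin d) (Fin d) ℝ) : frob Aᵀ = frob A := by
  rw [frob, frobSq_transpose, frob]

theorem frob_smul {c : ℝ} (hc : 0 ≤ c) (A : Matrix (Fin d) (Fin d) ℝ) :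
    frob (c • A) = c * frob A := by
  rw [frob, frobSq_smul, Real.sqrt_mul (sq_nonneg c), Real.sqrt_sq hc, frob]

theorem frob_neg (A : Matrix (Fin d) (Fin d) ℝ) : frob (-A) = frob A := by
  simp [frob, frobSq]

theorem finner_sq_le (A B : Matrix (Fin d) (Fin d) ℝ) :
    finner A B ^ 2 ≤ frobSq A * frobSq B := by
  simp only [finner, frobSq, ← Fintype.sum_prod_type']
  exact Finset.sum_mul_sq_le_sq_mul_sq _ _ _

theorem abs_finner_le (A B : Matrix (Fin d) (Fin d) ℝ) : |finner A B| ≤ frob A * frob B := by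
  apply abs_le_of_sq_le_sq _ (mul_nonneg (frob_nonneg A) (frob_nonneg B))
  rw [mul_pow, frob_sq, frob_sq]
  exact finner_sq_le A B

theorem frob_add_le (A B : Matrix (Fin d) (Fin d) ℝ) : frob (A + B) ≤ frob A + frob B := by
  apply le_of_sq_le_sq _ (add_nonneg (frob_nonneg A) (frob_nonneg B))
  rw [frob_sq, frobSq_add, ← frob_sq, ← frob_sq]
  nlinarith [(abs_le.1 (abs_finner_le A B)).2]

theorem frobSq_mul_le (A B : Matrix (Fin d) (Fin d) ℝ) :
    frobSq (A * B) ≤ frobSq A * frobSq B := by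
  have h : frobSq B = ∑ j, ∑ k, B k j ^ 2 := Finset.sum_comm
  rw [h]
  rw [frobSq, frobSq, Finset.sum_mul_sum]
  refine Finset.sum_le_sum fun i _ => Finset.sum_le_sum fun j _ => ?_
  exact Finset.sum_mul_sq_le_sq_mul_sq Finset.univ (fun k => A i k) fun k => B k j

theorem frob_mul_le (A B : Matrix (Fin d) (Fin d) ℝ) : frob (A * B) ≤ frob A * frob B := by
  rw [frob, frob, frob, ← Real.sqrt_mul (frobSq_nonneg A)]
  exact Real.sqrt_le_sqrt (frobSq_mul_le A B)

theorem eq_zero_of_frobSq {A : Matrix (Fin d) (Fin d) ℝ} (h : frobSq A ≤ 0) : A = 0 := by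
  ext i j
  have h1 : A i j ^ 2 ≤ ∑ j, A i j ^ 2 :=
    Finset.single_le_sum (f := fun j => A i j ^ 2) (fun _ _ => sq_nonneg _) (Finset.mem_univ j)
  have h2 : ∑ j, A i j ^ 2 ≤ frobSq A :=
    Finset.single_le_sum (f := fun i => ∑ j, A i j ^ 2)
      (fun _ _ => Finset.sum_nonneg fun _ _ => sq_nonneg _) (Finset.mem_univ i)
  exact pow_eq_zero_iff two_ne_zero |>.1 (le_antisymm (by linarith) (sq_nonneg _))

/-- Left multiplication by `A` has Frobenius operator norm at most `c`. -/
def OpBound (A : Matrix (Fin d) (Fin d) ℝ) (c : ℝ) : Prop :=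
  ∀ X : Matrix (Fin d) (Fin d) ℝ, frob (A * X) ≤ c * frob X

theorem OpBound.one : OpBound (1 : Matrix (Fin d) (Fin d) ℝ) 1 := fun X => by simp

theorem OpBound.of_frob {A : Matrix (Fin d) (Fin d) ℝ} {c : ℝ} (h : frob A ≤ c) :
    OpBound A c := fun X =>
  (frob_mul_le A X).trans (mul_le_mul_of_nonneg_right h (frob_nonneg X))

theorem OpBound.mul {A B : Matrix (Fin d) (Fin d) ℝ} {a b : ℝ} (ha : 0 ≤ a)
    (hA : OpBound A a) (hB : OpBound B b) : OpBound (A * B) (a * b) := fun X => by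
  rw [Matrix.mul_assoc, mul_assoc]
  exact (hA _).trans (mul_le_mul_of_nonneg_left (hB X) ha)

theorem OpBound.of_frobSq {A : Matrix (Fin d) (Fin d) ℝ} {c : ℝ} (hc : 0 ≤ c)
    (h : ∀ X, frobSq (A * X) ≤ c ^ 2 * frobSq X) : OpBound A c := fun X => by
  apply le_of_sq_le_sq _ (mul_nonneg hc (frob_nonneg X))
  rw [mul_pow, frob_sq, frob_sq]
  exact h X

theorem OpBound.frobSq_le {A : Matrix (Fin d) (Fin d) ℝ} {c : ℝ}
    (h : OpBound A c) (X : Matrix (Fin d) (Fin d) ℝ) : frobSq (A * X) ≤ c ^ 2 * frobSq X := by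
  rw [← frob_sq, ← frob_sq, ← mul_pow]
  exact pow_le_pow_left₀ (frob_nonneg _) (h X) 2

theorem OpBound.transpose {A : Matrix (Fin d) (Fin d) ℝ} {c : ℝ} (hc : 0 ≤ c)
    (h : OpBound A c) : OpBound Aᵀ c := fun X => by
  have h1 : frob (Aᵀ * X) ^ 2 ≤ frob X * (c * frob (Aᵀ * X)) := by
    rw [frob_sq, ← finner_self, finner_mul_left, transpose_transpose]
    exact (le_abs_self _).trans ((abs_finner_le _ _).trans
      (mul_le_mul_of_nonneg_left (h _) (frob_nonneg X)))
  rcases (frob_nonneg (Aᵀ * X)).eq_or_lt with h0 | h0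
  · rw [← h0]; exact mul_nonneg hc (frob_nonneg X)
  · nlinarith

theorem OpBound.frob_mul_right {A : Matrix (Fin d) (Fin d) ℝ} {c : ℝ} (hc : 0 ≤ c)
    (h : OpBound A c) (X : Matrix (Fin d) (Fin d) ℝ) : frob (X * A) ≤ c * frob X := by
  rw [← frob_transpose (X * A), transpose_mul, ← frob_transpose X]
  exact h.transpose hc _

theorem frobSq_gram_lower {A Z : Matrix (Fin d) (Fin d) ℝ} {c : ℝ}
    (h : c * frobSq Z ≤ frobSq (Aᵀ * Z)) :
    c * frobSq (Aᵀ * Z) ≤ frobSq (A * (Aᵀ * Z)) := by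
  have h1 := finner_sq_le Z (A * (Aᵀ * Z))
  rw [finner_comm, finner_mul_left, finner_self] at h1
  rcases (frobSq_nonneg (Aᵀ * Z)).eq_or_lt with h0 | h0
  · rw [← h0, mul_zero]; exact frobSq_nonneg _
  · have hZ : 0 < frobSq Z := by
      rcases (frobSq_nonneg Z).eq_or_lt with h2 | h2
      · rw [← h2, zero_mul] at h1; nlinarith
      · exact h2
    have h3 : (c * frobSq (Aᵀ * Z)) * frobSq Z ≤ frobSq (A * (Aᵀ * Z)) * frobSq Z := by nlinarith
    exact le_of_mul_le_mul_right h3 hZ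

/-- A square matrix and its transpose have the same least singular value. -/
theorem frobSq_lower_of_transpose {A : Matrix (Fin d) (Fin d) ℝ} {c : ℝ} (hc : 0 < c)
    (h : ∀ X : Matrix (Fin d) (Fin d) ℝ, c * frobSq X ≤ frobSq (Aᵀ * X))
    (Y : Matrix (Fin d) (Fin d) ℝ) : c * frobSq Y ≤ frobSq (A * Y) := by
  have hinj : Function.Injective (LinearMap.mulLeft ℝ Aᵀ) := by
    rw [← LinearMap.ker_eq_bot, LinearMap.ker_eq_bot']
    intro X hX
    have h1 := h X
    rw [LinearMap.mulLeft_apply] at hX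
    have h2 : frobSq (0 : Matrix (Fin d) (Fin d) ℝ) = 0 := by simp [frobSq]
    rw [hX, h2] at h1
    exact eq_zero_of_frobSq (by nlinarith)
  obtain ⟨X, rfl⟩ := LinearMap.injective_iff_surjective.1 hinj Y
  exact frobSq_gram_lower (h X)

theorem seg_one_succ (W : ℕ → Matrix (Fin d) (Fin d) ℝ) (k : ℕ) :
    seg W 1 (k + 1) = W (k + 1) * seg W 1 k := by
  rw [seg, if_neg (by omega)]

theorem seg_of_lt (W : ℕ → Matrix (Fin d) (Fin d) ℝ) {l k : ℕ} (h : k < l) :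
    seg W l k = 1 := by
  cases k with
  | zero => rfl
  | succ k => rw [seg, if_pos h]

theorem seg_peel_right (W : ℕ → Matrix (Fin d) (Fin d) ℝ) {l : ℕ} (hl : 1 ≤ l) :
    ∀ {k : ℕ}, l ≤ k → seg W l k = seg W (l + 1) k * W l
  | 0, h => by omega
  | k + 1, h => by
    rcases h.eq_or_lt with h | h
    · subst h
      rw [seg_of_lt W (Nat.lt_succ_self _), seg, if_neg (by omega),
        seg_of_lt W (Nat.lt_succ_self _), Matrix.one_mul, Matrix.mul_one]
    · rw [seg, if_neg (by omega), seg_peel_right W hl (Nat.lt_succ_iff.1 h), seg,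
        if_neg (by omega), Matrix.mul_assoc]

theorem OpBound.seg {W : ℕ → Matrix (Fin d) (Fin d) ℝ} {b : ℝ} (hb : 0 ≤ b) {l : ℕ} (hl : 1 ≤ l) :
    ∀ {k : ℕ}, (∀ i, 1 ≤ i → i ≤ k → OpBound (W i) b) → OpBound (seg W l k) (b ^ (k + 1 - l))
  | 0, _ => by
    rw [seg_of_lt W (by omega), Nat.sub_eq_zero_of_le (by omega), pow_zero]
    exact OpBound.one
  | k + 1, h => by
    by_cases hk : k + 1 < l
    · rw [seg_of_lt W hk, Nat.sub_eq_zero_of_le (by omega), pow_zero]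
      exact OpBound.one
    · rw [ZAS.seg, if_neg hk, show k + 1 + 1 - l = (k + 1 - l) + 1 by omega, pow_succ']
      exact (h _ (by omega) le_rfl).mul hb (OpBound.seg hb hl fun i h1 h2 => h i h1 (by omega))

/-- Lower bound for a product of approximately balanced factors: along the orbit of `V` the growth
ratios can drop by at most `ε` at each step. -/
theorem frobSq_seg_lower {W : ℕ → Matrix (Fin d) (Fin d) ℝ} {ε : ℝ} (hε : 0 ≤ ε) :
    ∀ (m : ℕ) (V : Matrix (Fin d) (Fin d) ℝ) (c : ℝ),
      (∀ l, 1 ≤ l → l < m → ∀ X : Matrix (Fin d) (Fin d) ℝ,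
        frobSq (W (l + 1) * X) - ε * frobSq X ≤ frobSq ((W l)ᵀ * X)) →
      m * ε ≤ c → c * frobSq V ≤ frobSq ((W m)ᵀ * V) →
      (c - m * ε) ^ m * frobSq V ≤ frobSq ((seg W 1 m)ᵀ * V)
  | 0, V, c, _, _, _ => by simp [seg]
  | 1, V, c, _, _, h => by
    simp only [seg, lt_irrefl, if_false, Matrix.mul_one, Nat.cast_one, pow_one, zero_add]
    nlinarith [frobSq_nonneg V]
  | m + 2, V, c, hbal, hc, h => by
    push_cast at hc
    have h1 := frobSq_gram_lower h
    have h2 := hbal (m + 1) (by omega) (by omega) ((W (m + 2))ᵀ * V)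
    have h3 := frobSq_seg_lower hε (m + 1) ((W (m + 2))ᵀ * V) (c - ε)
      (fun l hl hl' => hbal l hl (by omega)) (by push_cast; linarith) (by linarith)
    rw [seg_one_succ, transpose_mul, Matrix.mul_assoc]
    refine le_trans ?_ h3
    have h4 : c - ε - ((m + 1 : ℕ) : ℝ) * ε = c - ((m + 2 : ℕ) : ℝ) * ε := by push_cast; ring
    rw [h4, pow_succ, mul_assoc]
    have h5 : 0 ≤ c - ((m + 2 : ℕ) : ℝ) * ε := by push_cast; linarith
    refine mul_le_mul_of_nonneg_left (le_trans ?_ h) (pow_nonneg h5 _)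
    refine mul_le_mul_of_nonneg_right ?_ (frobSq_nonneg V)
    nlinarith [mul_nonneg (Nat.cast_nonneg (α := ℝ) (m + 2)) hε]

/-- The layers `W 1, …, W (m + 1)` satisfy the conservation laws of gradient flow started at the
zero-asymmetric initialization, up to an error `ε` in operator norm. -/
def Balanced (W : ℕ → Matrix (Fin d) (Fin d) ℝ) (m : ℕ) (ε : ℝ) : Prop :=
  ∀ l, 1 ≤ l → l ≤ m → ∀ X : Matrix (Fin d) (Fin d) ℝ,
    |frobSq (W (l + 1) * X) + (if l = m then frobSq X else 0) - frobSq ((W l)ᵀ * X)|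
      ≤ ε * frobSq X

theorem Balanced.mono {W : ℕ → Matrix (Fin d) (Fin d) ℝ} {m : ℕ} {ε ε' : ℝ}
    (h : Balanced W m ε) (hε : ε ≤ ε') : Balanced W m ε' := fun l h1 h2 X =>
  (h l h1 h2 X).trans (mul_le_mul_of_nonneg_right hε (frobSq_nonneg X))

theorem transpose_mul_grad_succ (W : ℕ → Matrix (Fin d) (Fin d) ℝ)
    (Φ : Matrix (Fin d) (Fin d) ℝ) {L l : ℕ} (hl : 1 ≤ l) (hL : l + 1 ≤ L) :
    (W (l + 1))ᵀ * grad W Φ L (l + 1) = grad W Φ L l * (W l)ᵀ := by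
  obtain ⟨k, rfl⟩ : ∃ k, l = k + 1 := ⟨l - 1, by omega⟩
  simp only [grad, Nat.add_sub_cancel]
  rw [seg_peel_right W (by omega) hL, seg_one_succ W k]
  simp only [transpose_mul, Matrix.mul_assoc]

theorem Balanced.gradient_step {W W' : ℕ → Matrix (Fin d) (Fin d) ℝ}
    {Φ : Matrix (Fin d) (Fin d) ℝ} {m : ℕ} {ε η γ : ℝ} (h : Balanced W m ε)
    (hupd : ∀ l, 1 ≤ l → l ≤ m + 1 → W' l = W l - η • grad W Φ (m + 1) l)
    (hγ : ∀ l, 1 ≤ l → l ≤ m + 1 → frobSq (grad W Φ (m + 1) l) ≤ γ) :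
    Balanced W' m (ε + η ^ 2 * γ) := by
  intro l h1 h2 X
  have e1 : frobSq (W' (l + 1) * X) = frobSq (W (l + 1) * X)
      - 2 * η * finner X (grad W Φ (m + 1) l * (W l)ᵀ * X)
      + η ^ 2 * frobSq (grad W Φ (m + 1) (l + 1) * X) := by
    rw [hupd _ (by omega) (by omega), Matrix.sub_mul, Matrix.smul_mul, frobSq_sub_smul,
      finner_mul_left, ← Matrix.mul_assoc, transpose_mul_grad_succ W Φ h1 (by omega)]
  have e2 : frobSq ((W' l)ᵀ * X) = frobSq ((W l)ᵀ * X)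
      - 2 * η * finner X (grad W Φ (m + 1) l * (W l)ᵀ * X)
      + η ^ 2 * frobSq ((grad W Φ (m + 1) l)ᵀ * X) := by
    rw [hupd _ (by omega) (by omega), transpose_sub, transpose_smul, Matrix.sub_mul,
      Matrix.smul_mul, frobSq_sub_smul, finner_comm ((W l)ᵀ * X), finner_mul_left,
      transpose_transpose, Matrix.mul_assoc]
  have b1 : frobSq (grad W Φ (m + 1) (l + 1) * X) ≤ γ * frobSq X :=
    (frobSq_mul_le _ _).trans
      (mul_le_mul_of_nonneg_right (hγ _ (by omega) (by omega)) (frobSq_nonneg X))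
  have b2 : frobSq ((grad W Φ (m + 1) l)ᵀ * X) ≤ γ * frobSq X := by
    refine (frobSq_mul_le _ _).trans (mul_le_mul_of_nonneg_right ?_ (frobSq_nonneg X))
    rw [frobSq_transpose]
    exact hγ _ h1 (by omega)
  have h3 := abs_le.1 (h l h1 h2 X)
  have c1 := mul_le_mul_of_nonneg_left b1 (sq_nonneg η)
  have c2 := mul_le_mul_of_nonneg_left b2 (sq_nonneg η)
  have c3 := mul_nonneg (sq_nonneg η) (frobSq_nonneg (grad W Φ (m + 1) (l + 1) * X))
  have c4 := mul_nonneg (sq_nonneg η) (frobSq_nonneg ((grad W Φ (m + 1) l)ᵀ * X))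
  rw [e1, e2, abs_le]
  constructor <;> linarith [h3.1, h3.2]

theorem Balanced.lower {W : ℕ → Matrix (Fin d) (Fin d) ℝ} {m : ℕ} {ε ρ : ℝ}
    (h : Balanced W m ε) (hε : 0 ≤ ε) (hm : 1 ≤ m) (hε1 : ((m : ℝ) + 1) * ε ≤ 1) (hρ : 0 ≤ ρ)
    (V : Matrix (Fin d) (Fin d) ℝ) (hV : ρ * frobSq V ≤ frobSq (W (m + 1) * V)) :
    (1 + ρ - ((m : ℝ) + 1) * ε) ^ m * frobSq V ≤ frobSq ((seg W 1 m)ᵀ * V) := by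
  have h1 := frobSq_seg_lower (W := W) hε m V (1 + ρ - ε) ?_ (by linarith) ?_
  · rwa [show 1 + ρ - ε - m * ε = 1 + ρ - ((m : ℝ) + 1) * ε by ring] at h1
  · intro l hl hlm X
    have h2 := (abs_le.1 (h l hl hlm.le X)).2
    rw [if_neg hlm.ne] at h2
    linarith
  · have h2 := (abs_le.1 (h m hm le_rfl V)).2
    rw [if_pos rfl] at h2
    linarith

theorem Balanced.opBound_last {W : ℕ → Matrix (Fin d) (Fin d) ℝ} {m : ℕ} {ε α φ : ℝ}
    (h : Balanced W m ε) (hε : 0 ≤ ε) (hm : 1 ≤ m) (hε1 : ((m : ℝ) + 1) * ε ≤ 1) (hα : 0 ≤ α)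
    (hαφ : α * (1 + α - ((m : ℝ) + 1) * ε) ^ m = φ ^ 2)
    (hP : frob (seg W 1 (m + 1)) ≤ φ) : OpBound (W (m + 1)) (√α) := by
  have key : OpBound (W (m + 1))ᵀ (√α) := by
    refine OpBound.of_frobSq (Real.sqrt_nonneg _) fun X => ?_
    rw [Real.sq_sqrt hα]
    by_contra! hlt
    have hX : 0 < frobSq X := by
      rcases (frobSq_nonneg X).eq_or_lt with h0 | h0
      · rw [eq_zero_of_frobSq h0.ge] at hlt
        simp [frobSq] at hlt
      · exact h0
    set ρ := frobSq ((W (m + 1))ᵀ * X) / frobSq X with hρ_def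
    have hρX : ρ * frobSq X = frobSq ((W (m + 1))ᵀ * X) := div_mul_cancel₀ _ hX.ne'
    have hαρ : α < ρ := by rwa [hρ_def, lt_div_iff₀ hX]
    have h1 := h.lower hε hm hε1 (hα.trans hαρ.le) _ (frobSq_gram_lower hρX.le)
    rw [← hρX, ← Matrix.mul_assoc, ← transpose_mul, ← seg_one_succ] at h1
    have h2 : frobSq ((seg W 1 (m + 1))ᵀ * X) ≤ φ ^ 2 * frobSq X := by
      refine (frobSq_mul_le _ _).trans (mul_le_mul_of_nonneg_right ?_ hX.le)
      rw [frobSq_transpose, ← frob_sq]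
      exact pow_le_pow_left₀ (frob_nonneg _) hP 2
    have h3 : (1 + ρ - ((m : ℝ) + 1) * ε) ^ m * ρ ≤ φ ^ 2 :=
      le_of_mul_le_mul_right (by linarith) hX
    have h4 : (1 + α - ((m : ℝ) + 1) * ε) ^ m ≤ (1 + ρ - ((m : ℝ) + 1) * ε) ^ m :=
      pow_le_pow_left₀ (by linarith) (by linarith) m
    have h5 : 0 < (1 + ρ - ((m : ℝ) + 1) * ε) ^ m := pow_pos (by linarith) m
    nlinarith [mul_le_mul_of_nonneg_left h4 hα]
  simpa using key.transpose (Real.sqrt_nonneg _)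

theorem Balanced.opBound_of_le {W : ℕ → Matrix (Fin d) (Fin d) ℝ} {m : ℕ} {ε α b : ℝ}
    (h : Balanced W m ε) (hε : 0 ≤ ε) (hα : 0 ≤ α)
    (hL : OpBound (W (m + 1)) (√α)) (hb : 0 ≤ b) (hb2 : b ^ 2 = 1 + α + ((m : ℝ) + 1) * ε)
    {l : ℕ} (h1 : 1 ≤ l) (h2 : l ≤ m) : OpBound (W l) b := by
  have key : ∀ j l, 1 ≤ l → l + j = m → ∀ X : Matrix (Fin d) (Fin d) ℝ,
      frobSq ((W l)ᵀ * X) ≤ (1 + α + ((j : ℝ) + 1) * ε) * frobSq X := by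
    intro j
    induction j with
    | zero =>
      intro l hl hlm X
      obtain rfl : l = m := by omega
      have h3 := (abs_le.1 (h l hl le_rfl X)).1
      have h4 := hL.frobSq_le X
      rw [Real.sq_sqrt hα] at h4
      rw [if_pos rfl] at h3
      push_cast
      linarith
    | succ j ih =>
      intro l hl hlm X
      have h3 := (abs_le.1 (h l hl (by omega) X)).1
      rw [if_neg (by omega)] at h3
      have hc : 0 ≤ 1 + α + ((j : ℝ) + 1) * ε := by positivity
      have h5 : OpBound (W (l + 1)) (√(1 + α + ((j : ℝ) + 1) * ε)) := by
        have h6 : OpBound (W (l + 1))ᵀ (√(1 + α + ((j : ℝ) + 1) * ε)) :=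
          OpBound.of_frobSq (Real.sqrt_nonneg _) fun X => by
            rw [Real.sq_sqrt hc]; exact ih (l + 1) (by omega) (by omega) X
        simpa using h6.transpose (Real.sqrt_nonneg _)
      have h4 := h5.frobSq_le X
      rw [Real.sq_sqrt hc] at h4
      push_cast
      linarith
  have h3 : OpBound (W l)ᵀ b := by
    refine OpBound.of_frobSq hb fun X => ?_
    refine (key (m - l) l h1 (by omega) X).trans
      (mul_le_mul_of_nonneg_right ?_ (frobSq_nonneg X))
    rw [hb2]
    have : ((m - l : ℕ) : ℝ) ≤ m := by exact_mod_cast Nat.sub_le m l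
    nlinarith
  simpa using h3.transpose hb

theorem frob_grad_le {W : ℕ → Matrix (Fin d) (Fin d) ℝ} (Φ : Matrix (Fin d) (Fin d) ℝ)
    {m : ℕ} {a b : ℝ} (ha : 0 ≤ a) (hb : 1 ≤ b) (hL : OpBound (W (m + 1)) a)
    (hW : ∀ l, 1 ≤ l → l ≤ m → OpBound (W l) b) {l : ℕ} (h1 : 1 ≤ l) (h2 : l ≤ m) :
    frob (grad W Φ (m + 1) l) ≤ a * b ^ m * frob (seg W 1 (m + 1) - Φ) := by
  have hb0 : 0 ≤ b := zero_le_one.trans hb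
  have hA : OpBound (seg W (l + 1) (m + 1)) (a * b ^ (m - l)) := by
    rw [seg, if_neg (by omega), show m - l = m + 1 - (l + 1) by omega]
    exact hL.mul ha (OpBound.seg hb0 (by omega) hW)
  have hB : OpBound (seg W 1 (l - 1)) (b ^ (l - 1)) :=
    OpBound.seg hb0 le_rfl fun i hi hi' => hW i hi (by omega)
  have hA0 : 0 ≤ a * b ^ (m - l) := by positivity
  calc frob (grad W Φ (m + 1) l)
      ≤ b ^ (l - 1) * (a * b ^ (m - l) * frob (seg W 1 (m + 1) - Φ)) :=
        ((hB.transpose (by positivity)).frob_mul_right (by positivity) _).trans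
          (mul_le_mul_of_nonneg_left (hA.transpose hA0 _) (by positivity))
    _ = a * b ^ (m - 1) * frob (seg W 1 (m + 1) - Φ) := by
        rw [show m - 1 = (l - 1) + (m - l) by omega, pow_add]; ring
    _ ≤ a * b ^ m * frob (seg W 1 (m + 1) - Φ) := by
        have := pow_le_pow_right₀ hb (Nat.sub_le m 1)
        have := frob_nonneg (seg W 1 (m + 1) - Φ)
        gcongr

theorem grad_last (W : ℕ → Matrix (Fin d) (Fin d) ℝ) (Φ : Matrix (Fin d) (Fin d) ℝ) (m : ℕ) :
    grad W Φ (m + 1) (m + 1) = (seg W 1 (m + 1) - Φ) * (seg W 1 m)ᵀ := by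
  rw [grad, seg_of_lt W (Nat.lt_succ_self _), transpose_one, Matrix.one_mul, Nat.add_sub_cancel]

theorem frob_grad_last_le {W : ℕ → Matrix (Fin d) (Fin d) ℝ} (Φ : Matrix (Fin d) (Fin d) ℝ)
    {m : ℕ} {b : ℝ} (hb : 0 ≤ b) (hW : ∀ l, 1 ≤ l → l ≤ m → OpBound (W l) b) :
    frob (grad W Φ (m + 1) (m + 1)) ≤ b ^ m * frob (seg W 1 (m + 1) - Φ) := by
  rw [grad_last]
  exact ((OpBound.seg hb le_rfl hW).transpose (by positivity)).frob_mul_right (by positivity) _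

/-- The derivative of `seg W 1 k` in the direction `G`. -/
noncomputable def segDeriv (W G : ℕ → Matrix (Fin d) (Fin d) ℝ) :
    ℕ → Matrix (Fin d) (Fin d) ℝ
  | 0 => 0
  | k + 1 => W (k + 1) * segDeriv W G k + G (k + 1) * seg W 1 k

theorem frob_segDeriv_le {W G : ℕ → Matrix (Fin d) (Fin d) ℝ} {b g : ℝ} (hb : 1 ≤ b)
    (hg : 0 ≤ g) : ∀ {k : ℕ}, (∀ l, 1 ≤ l → l ≤ k → OpBound (W l) b) →
      (∀ l, 1 ≤ l → l ≤ k → frob (G l) ≤ g) → frob (segDeriv W G k) ≤ k * g * b ^ k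
  | 0, _, _ => by simp [segDeriv, frob, frobSq]
  | k + 1, hW, hG => by
    have hb0 : 0 ≤ b := zero_le_one.trans hb
    have ih := frob_segDeriv_le hb hg (fun l h1 h2 => hW l h1 (Nat.le_succ_of_le h2))
      fun l h1 h2 => hG l h1 (Nat.le_succ_of_le h2)
    have h1 := (hW (k + 1) (by omega) le_rfl (segDeriv W G k)).trans
      (mul_le_mul_of_nonneg_left ih hb0)
    have h2 : frob (G (k + 1) * seg W 1 k) ≤ b ^ k * g :=
      ((OpBound.seg hb0 le_rfl fun l h1 h2 => hW l h1 (Nat.le_succ_of_le h2)).frob_mul_right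
        (by positivity) _).trans
        (mul_le_mul_of_nonneg_left (hG _ (by omega) le_rfl) (by positivity))
    have h3 : b ^ k * g ≤ b ^ (k + 1) * g :=
      mul_le_mul_of_nonneg_right (pow_le_pow_right₀ hb (Nat.le_succ k)) hg
    refine (frob_add_le _ _).trans ?_
    push_cast
    rw [pow_succ] at h3 ⊢
    linarith

/-- One more factor in the second-order Taylor remainder of a product. -/
theorem frob_remainder_succ_le {W G W' : ℕ → Matrix (Fin d) (Fin d) ℝ} {η w g f q : ℝ} {k : ℕ}
    (hη : 0 ≤ η) (hg : 0 ≤ g)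
    (hupd : W' (k + 1) = W (k + 1) - η • G (k + 1)) (hW : OpBound (W (k + 1)) w) (hw : 0 ≤ w)
    (hG : frob (G (k + 1)) ≤ g) (hF : frob (segDeriv W G k) ≤ f)
    (hQ : frob (seg W' 1 k - seg W 1 k + η • segDeriv W G k) ≤ q) :
    frob (seg W' 1 (k + 1) - seg W 1 (k + 1) + η • segDeriv W G (k + 1))
      ≤ w * q + η * (g * q) + η * (η * (g * f)) := by
  set Q := seg W' 1 k - seg W 1 k + η • segDeriv W G k with hQ_def
  have hseg : seg W' 1 k = seg W 1 k - η • segDeriv W G k + Q := by rw [hQ_def]; abel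
  have e : seg W' 1 (k + 1) - seg W 1 (k + 1) + η • segDeriv W G (k + 1)
      = (W (k + 1) * Q + η • (-(G (k + 1) * Q))) + η • (η • (G (k + 1) * segDeriv W G k)) := by
    rw [seg_one_succ, seg_one_succ, hupd, hseg, segDeriv]
    simp only [Matrix.sub_mul, Matrix.mul_add, Matrix.mul_sub, Matrix.smul_mul, Matrix.mul_smul,
      smul_add, smul_sub, smul_neg]
    abel
  rw [e]
  have hGo := OpBound.of_frob hG
  refine (frob_add_le _ _).trans (add_le_add ((frob_add_le _ _).trans (add_le_add ?_ ?_)) ?_)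
  · exact (hW _).trans (mul_le_mul_of_nonneg_left hQ hw)
  · rw [frob_smul hη, frob_neg]
    exact mul_le_mul_of_nonneg_left
      ((hGo _).trans (mul_le_mul_of_nonneg_left hQ hg)) hη
  · rw [frob_smul hη, frob_smul hη]
    exact mul_le_mul_of_nonneg_left (mul_le_mul_of_nonneg_left
      ((hGo _).trans (mul_le_mul_of_nonneg_left hF hg)) hη) hη

theorem frob_remainder_le {W G W' : ℕ → Matrix (Fin d) (Fin d) ℝ} {η b g : ℝ}
    (hη : 0 ≤ η) (hb : 1 ≤ b) (hg : 0 ≤ g) : ∀ {k : ℕ},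
    (∀ l, 1 ≤ l → l ≤ k → W' l = W l - η • G l) →
    (∀ l, 1 ≤ l → l ≤ k → OpBound (W l) b) →
    (∀ l, 1 ≤ l → l ≤ k → frob (G l) ≤ g) → k * (η * g) ≤ 1 →
    frob (seg W' 1 k - seg W 1 k + η • segDeriv W G k) ≤ (k * (η * g)) ^ 2 * b ^ k
  | 0, _, _, _, _ => by simp [seg, segDeriv, frob, frobSq]
  | k + 1, hupd, hW, hG, hs => by
    have hb0 : 0 ≤ b := zero_le_one.trans hb
    have hW' : ∀ l, 1 ≤ l → l ≤ k → OpBound (W l) b :=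
      fun l h1 h2 => hW l h1 (Nat.le_succ_of_le h2)
    have hG' : ∀ l, 1 ≤ l → l ≤ k → frob (G l) ≤ g :=
      fun l h1 h2 => hG l h1 (Nat.le_succ_of_le h2)
    push_cast at hs ⊢
    set s := η * g with hs_def
    have hs0 : 0 ≤ s := mul_nonneg hη hg
    have hks : k * s ≤ 1 := by linarith
    have ih := frob_remainder_le hη hb hg
      (fun l h1 h2 => hupd l h1 (Nat.le_succ_of_le h2)) hW' hG' hks
    refine (frob_remainder_succ_le hη hg (hupd _ (by omega) le_rfl)
      (hW _ (by omega) le_rfl) hb0 (hG _ (by omega) le_rfl)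
      (frob_segDeriv_le hb hg hW' hG') ih).trans ?_
    have hB : b ^ k ≤ b ^ (k + 1) := pow_le_pow_right₀ hb (Nat.le_succ k)
    have hB0 : 0 ≤ b ^ k := by positivity
    have hk : (0 : ℝ) ≤ k := Nat.cast_nonneg k
    calc b * ((k * s) ^ 2 * b ^ k) + η * (g * ((k * s) ^ 2 * b ^ k))
          + η * (η * (g * (k * g * b ^ k)))
        = (k * s) ^ 2 * b ^ (k + 1) + (k * s) * (k * s ^ 2 * b ^ k) + k * s ^ 2 * b ^ k := by
          rw [hs_def, pow_succ]; ring
      _ ≤ (k * s) ^ 2 * b ^ (k + 1) + 1 * (k * s ^ 2 * b ^ (k + 1))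
          + k * s ^ 2 * b ^ (k + 1) := by gcongr
      _ ≤ ((k + 1) * s) ^ 2 * b ^ (k + 1) := by
          have : 0 ≤ s ^ 2 * b ^ (k + 1) := by positivity
          nlinarith

theorem finner_segDeriv_nonneg (W : ℕ → Matrix (Fin d) (Fin d) ℝ) (Φ : Matrix (Fin d) (Fin d) ℝ)
    (L : ℕ) : ∀ {k : ℕ}, k ≤ L →
      0 ≤ finner (seg W 1 L - Φ) (seg W (k + 1) L * segDeriv W (grad W Φ L) k)
  | 0, _ => by simp [segDeriv, finner]
  | k + 1, hk => by
    rw [segDeriv, Matrix.mul_add, finner_add_right, ← Matrix.mul_assoc,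
      ← seg_peel_right W (by omega) hk]
    refine add_nonneg (finner_segDeriv_nonneg W Φ L (by omega)) ?_
    rw [← Matrix.mul_assoc, finner_comm, finner_mul_right, finner_mul_left, ← Matrix.mul_assoc]
    exact (finner_self (grad W Φ L (k + 1))).ge.trans' (frobSq_nonneg _)

theorem frobSq_grad_last_le_finner (W : ℕ → Matrix (Fin d) (Fin d) ℝ)
    (Φ : Matrix (Fin d) (Fin d) ℝ) (m : ℕ) :
    frobSq (grad W Φ (m + 1) (m + 1))
      ≤ finner (seg W 1 (m + 1) - Φ) (segDeriv W (grad W Φ (m + 1)) (m + 1)) := by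
  have h := finner_segDeriv_nonneg W Φ (m + 1) (Nat.le_succ m)
  rw [seg_peel_right W (by omega) le_rfl, seg_of_lt W (Nat.lt_succ_self _), Matrix.one_mul] at h
  rw [segDeriv, finner_add_right, finner_comm _ (grad W Φ (m + 1) (m + 1) * _), finner_mul_right,
    ← grad_last, finner_self]
  linarith

set_option maxHeartbeats 1000000 in
theorem frobSq_gradient_step_le {W W' : ℕ → Matrix (Fin d) (Fin d) ℝ}
    {Φ : Matrix (Fin d) (Fin d) ℝ} {m : ℕ} {η φ a b : ℝ} (hη : 0 ≤ η) (hφ : 1 ≤ φ)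
    (hηφ : η * ((m : ℝ) + 1) ^ 2 * φ ^ 4 ≤ 1 / 144)
    (hupd : ∀ l, 1 ≤ l → l ≤ m + 1 → W' l = W l - η • grad W Φ (m + 1) l)
    (ha : 0 ≤ a) (hb : 1 ≤ b) (hL : OpBound (W (m + 1)) a)
    (hW : ∀ l, 1 ≤ l → l ≤ m → OpBound (W l) b)
    (hab : (a * b ^ m) ^ 2 ≤ 3 * φ ^ 2) (hbm : (b ^ m) ^ 2 ≤ 3 * ((m : ℝ) + 1) * φ ^ 2)
    (hlow : ∀ X : Matrix (Fin d) (Fin d) ℝ, 5 / 8 * frobSq X ≤ frobSq (seg W 1 m * X))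
    (hr : frob (seg W 1 (m + 1) - Φ) ≤ φ / 2) :
    frobSq (seg W' 1 (m + 1) - Φ) ≤ (1 - η / 2) * frobSq (seg W 1 (m + 1) - Φ) := by
  set E := seg W 1 (m + 1) - Φ with hE
  set F := segDeriv W (grad W Φ (m + 1)) (m + 1) with hF
  set Q := seg W' 1 (m + 1) - seg W 1 (m + 1) + η • F with hQ
  set K := b ^ m with hK
  set r := frob E with hr_def
  set M : ℝ := (m : ℝ) + 1 with hM
  have hmM : (m : ℝ) ≤ M := by linarith
  have hM1 : 1 ≤ M := by linarith [Nat.cast_nonneg (α := ℝ) m]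
  have hm0 : (0 : ℝ) ≤ m := Nat.cast_nonneg m
  have hr0 : 0 ≤ r := frob_nonneg E
  have hK0 : 0 ≤ K := by positivity
  have haK0 : 0 ≤ a * K := mul_nonneg ha hK0
  have hg0 : 0 ≤ a * K * r := mul_nonneg haK0 hr0
  have haK : a * K ≤ 2 * φ := by
    apply le_of_sq_le_sq _ (by linarith)
    nlinarith
  have hG : ∀ l, 1 ≤ l → l ≤ m → frob (grad W Φ (m + 1) l) ≤ a * K * r :=
    fun l h1 h2 => frob_grad_le Φ ha hb hL hW h1 h2
  have hGL : frob (grad W Φ (m + 1) (m + 1)) ≤ K * r :=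
    frob_grad_last_le Φ (zero_le_one.trans hb) hW
  have hFm := frob_segDeriv_le (G := grad W Φ (m + 1)) hb hg0 hW hG
  -- smallness of the step
  have hu : η * M ^ 2 * φ ^ 3 * r ≤ 1 / 288 := by
    have : η * M ^ 2 * φ ^ 3 * r ≤ η * M ^ 2 * φ ^ 3 * (φ / 2) := by gcongr
    nlinarith
  have hs0 : 0 ≤ m * (η * (a * K * r)) := by positivity
  have hsM : m * (η * (a * K * r)) ≤ 2 * (η * M * φ * r) := by
    calc m * (η * (a * K * r)) ≤ M * (η * (2 * φ * r)) := by gcongr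
      _ = 2 * (η * M * φ * r) := by ring
  have hsmall : m * (η * (a * K * r)) ≤ 1 / 144 := by
    have h1 : η * M * φ * r ≤ η * M ^ 2 * φ ^ 3 * r := by
      have := le_self_pow₀ hM1 two_ne_zero
      have := le_self_pow₀ hφ three_ne_zero
      gcongr
    linarith
  have hRm := frob_remainder_le (G := grad W Φ (m + 1)) (W' := W') hη hb hg0
    (fun l h1 h2 => hupd l h1 (Nat.le_succ_of_le h2)) hW hG (by linarith)
  -- first-order term
  have hKr : K ^ 2 * r ≤ 3 * M * φ ^ 2 * r := mul_le_mul_of_nonneg_right hbm hr0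
  have hFn : frob F ≤ 6 * M * φ ^ 2 * r := by
    have h1 : frob F ≤ a * (m * (a * K * r) * K) + K * (K * r) := by
      refine (frob_add_le _ _).trans (add_le_add ?_ ?_)
      · exact (hL _).trans (mul_le_mul_of_nonneg_left hFm ha)
      · exact ((OpBound.seg (zero_le_one.trans hb) le_rfl hW).frob_mul_right hK0 _).trans
          (mul_le_mul_of_nonneg_left hGL hK0)
    have h2 : a * (m * (a * K * r) * K) ≤ M * (3 * φ ^ 2) * r := by
      calc a * (m * (a * K * r) * K) = m * (a * K) ^ 2 * r := by ring
        _ ≤ M * (3 * φ ^ 2) * r := by gcongr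
    linarith
  have hFsq : η * frobSq F ≤ r ^ 2 / 4 := by
    rw [← frob_sq]
    calc η * frob F ^ 2 ≤ η * (6 * M * φ ^ 2 * r) ^ 2 := by gcongr; exact frob_nonneg F
      _ = 36 * (η * M ^ 2 * φ ^ 4) * r ^ 2 := by ring
      _ ≤ 36 * (1 / 144) * r ^ 2 := by gcongr
      _ = r ^ 2 / 4 := by ring
  have hEF : 5 / 8 * r ^ 2 ≤ finner E F := by
    refine le_trans ?_ (frobSq_grad_last_le_finner W Φ m)
    rw [grad_last, ← frobSq_transpose, transpose_mul, transpose_transpose, frob_sq,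
      ← frobSq_transpose E]
    exact hlow _
  -- remainder
  have hQn : frob Q ≤ η * r / 20 := by
    have h1 := frob_remainder_succ_le hη (mul_nonneg hK0 hr0) (hupd _ (by omega) le_rfl) hL ha
      hGL hFm hRm
    refine h1.trans ?_
    set s := m * (η * (a * K * r)) with hs
    have t1 : a * (s ^ 2 * K) ≤ 3 / 144 * (η * r) := by
      have e1 : s ^ 2 ≤ M ^ 2 * η ^ 2 * (3 * φ ^ 2) * r ^ 2 := by
        calc s ^ 2 = (m : ℝ) ^ 2 * η ^ 2 * (a * K) ^ 2 * r ^ 2 := by rw [hs]; ring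
          _ ≤ M ^ 2 * η ^ 2 * (3 * φ ^ 2) * r ^ 2 := by gcongr
      calc a * (s ^ 2 * K) = (a * K) * s ^ 2 := by ring
        _ ≤ (2 * φ) * (M ^ 2 * η ^ 2 * (3 * φ ^ 2) * r ^ 2) := by gcongr
        _ = 6 * (η * M ^ 2 * φ ^ 3 * r) * (η * r) := by ring
        _ ≤ 6 * (1 / 288) * (η * r) := by gcongr
        _ = 3 / 144 * (η * r) := by ring
    have t3 : η * (K ^ 2 * r) * s ≤ 3 / 144 * (η * r) := by
      calc η * (K ^ 2 * r) * s ≤ η * (3 * M * φ ^ 2 * r) * (2 * (η * M * φ * r)) := by gcongr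
        _ = 6 * (η * M ^ 2 * φ ^ 3 * r) * (η * r) := by ring
        _ ≤ 6 * (1 / 288) * (η * r) := by gcongr
        _ = 3 / 144 * (η * r) := by ring
    have t2 : η * (K * r * (s ^ 2 * K)) ≤ 1 / 144 * (3 / 144 * (η * r)) := by
      calc η * (K * r * (s ^ 2 * K)) = s * (η * (K ^ 2 * r) * s) := by ring
        _ ≤ 1 / 144 * (3 / 144 * (η * r)) := by gcongr
    have e3 : η * (η * (K * r * (m * (a * K * r) * K))) = η * (K ^ 2 * r) * s := by
      rw [hs]; ring
    rw [e3]
    have : 0 ≤ η * r := by positivity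
    linarith
  -- assembling
  have hη1 : η ≤ 1 / 144 := by
    refine le_trans ?_ hηφ
    have h1 : 1 ≤ M ^ 2 := one_le_pow₀ hM1
    have h2 : 1 ≤ φ ^ 4 := one_le_pow₀ hφ
    rw [mul_assoc]
    exact le_mul_of_one_le_right hη (one_le_mul_of_one_le_of_one_le h1 h2)
  have hD : frobSq (E - η • F) ≤ (1 - η) * r ^ 2 := by
    rw [frobSq_sub_smul, ← frob_sq]
    nlinarith
  have hDr : frob (E - η • F) ≤ r := by
    apply le_of_sq_le_sq _ hr0
    rw [frob_sq]
    nlinarith [mul_nonneg hη (sq_nonneg r)]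
  have e : seg W' 1 (m + 1) - Φ = (E - η • F) + Q := by rw [hQ, hE]; abel
  have hc : finner (E - η • F) Q ≤ r * (η * r / 20) :=
    (le_abs_self _).trans ((abs_finner_le _ _).trans
      (mul_le_mul hDr hQn (frob_nonneg Q) hr0))
  have hQ2 : frobSq Q ≤ (η * r / 20) ^ 2 := by
    rw [← frob_sq]; exact pow_le_pow_left₀ (frob_nonneg Q) hQn 2
  rw [e, frobSq_add, ← frob_sq E]
  have h1 : η * (η * r ^ 2) ≤ 1 / 144 * (η * r ^ 2) := by gcongr
  have h2 : 0 ≤ η * r ^ 2 := by positivity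
  nlinarith

/-- The scale `α` of `‖W_L‖²` at which an exactly balanced product reaches norm `φ`. -/
theorem exists_layer_scale {m : ℕ} (hm : 1 ≤ m) {φ δ : ℝ} (hφ : 1 ≤ φ)
    (hφm : 9 ≤ ((m : ℝ) + 1) * φ ^ 2) (hδ0 : 0 ≤ δ) (hδ : δ = 3 / (8 * ((m : ℝ) + 1))) :
    ∃ α : ℝ, 0 ≤ α ∧ α * (1 + α - δ) ^ m = φ ^ 2 ∧
      α * (1 + α + δ) ^ m ≤ 3 * φ ^ 2 ∧ (1 + α + δ) ^ m ≤ 3 * ((m : ℝ) + 1) * φ ^ 2 := by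
  have hm1 : (1 : ℝ) ≤ m := by exact_mod_cast hm
  set M : ℝ := (m : ℝ) + 1 with hM
  have hM0 : 0 < M := by linarith
  have hδM : M⁻¹ * 3 / 8 = δ := by rw [hδ]; field_simp
  have hMi : M⁻¹ ≤ 1 / 2 := by
    rw [inv_le_comm₀ hM0 (by norm_num)]; linarith
  have hMi0 : 0 < M⁻¹ := inv_pos.2 hM0
  have hexp : (1 + M⁻¹) ^ m ≤ 3 := by
    calc (1 + M⁻¹) ^ m ≤ Real.exp M⁻¹ ^ m := by
          gcongr; linarith [Real.add_one_le_exp M⁻¹]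
      _ = Real.exp (m * M⁻¹) := (Real.exp_nat_mul _ _).symm
      _ ≤ Real.exp 1 := by
          apply Real.exp_le_exp.2
          rw [← div_eq_mul_inv, div_le_one hM0]; linarith
      _ ≤ 3 := by linarith [Real.exp_one_lt_d9]
  have hcont : ContinuousOn (fun x : ℝ => x * (1 + x - δ) ^ m) (Set.Icc 0 (φ ^ 2)) := by fun_prop
  have hφ2 : 1 ≤ φ ^ 2 := one_le_pow₀ hφ
  obtain ⟨α, ⟨hα0, -⟩, hα⟩ := intermediate_value_Icc (by positivity) hcont
    (show φ ^ 2 ∈ Set.Icc ((fun x : ℝ => x * (1 + x - δ) ^ m) 0)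
        ((fun x : ℝ => x * (1 + x - δ) ^ m) (φ ^ 2)) by
      refine ⟨?_, ?_⟩
      · simp only [zero_mul]; positivity
      · exact le_mul_of_one_le_right (by positivity) (one_le_pow₀ (by linarith)))
  have hαe : α * (1 + α - δ) ^ m = φ ^ 2 := hα
  have hratio : (1 + α + δ) ^ m ≤ 3 * (1 + α - δ) ^ m := by
    have h1 : 1 + α + δ ≤ (1 + M⁻¹) * (1 + α - δ) := by nlinarith [mul_nonneg hMi0.le hα0]
    have h2 : 0 ≤ 1 + α - δ := by linarith
    calc (1 + α + δ) ^ m ≤ ((1 + M⁻¹) * (1 + α - δ)) ^ m := by gcongr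
      _ = (1 + M⁻¹) ^ m * (1 + α - δ) ^ m := mul_pow _ _ _
      _ ≤ 3 * (1 + α - δ) ^ m := by gcongr
  have h3 : α * (1 + α + δ) ^ m ≤ 3 * φ ^ 2 := by
    nlinarith [mul_le_mul_of_nonneg_left hratio hα0]
  refine ⟨α, hα0, hαe, h3, ?_⟩
  rcases le_total M⁻¹ α with h | h
  · have h4 : M⁻¹ * (1 + α + δ) ^ m ≤ 3 * φ ^ 2 :=
      (mul_le_mul_of_nonneg_right h (by positivity)).trans h3
    calc (1 + α + δ) ^ m = M * (M⁻¹ * (1 + α + δ) ^ m) := by field_simp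
      _ ≤ M * (3 * φ ^ 2) := by gcongr
      _ = 3 * M * φ ^ 2 := by ring
  · have h4 : 1 + α + δ ≤ (1 + M⁻¹) ^ 2 := by nlinarith
    calc (1 + α + δ) ^ m ≤ ((1 + M⁻¹) ^ 2) ^ m := by gcongr
      _ = ((1 + M⁻¹) ^ m) ^ 2 := by rw [← pow_mul, ← pow_mul, mul_comm]
      _ ≤ 3 ^ 2 := by gcongr
      _ ≤ 3 * M * φ ^ 2 := by linarith

/-- One step of gradient descent contracts the loss and keeps the layers nearly balanced. -/
theorem Balanced.descent {W W' : ℕ → Matrix (Fin d) (Fin d) ℝ}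
    {Φ : Matrix (Fin d) (Fin d) ℝ} {m : ℕ} {η φ ε : ℝ} (hm : 1 ≤ m)
    (h : Balanced W m ε) (hε : ε ≤ 3 / (8 * ((m : ℝ) + 1) ^ 2)) (hη : 0 ≤ η) (hφ : 1 ≤ φ)
    (hφm : 9 ≤ ((m : ℝ) + 1) * φ ^ 2) (hηφ : η * ((m : ℝ) + 1) ^ 2 * φ ^ 4 ≤ 1 / 144)
    (hΦ : frob Φ ≤ φ / 2) (hr : frob (seg W 1 (m + 1) - Φ) ≤ φ / 2)
    (hupd : ∀ l, 1 ≤ l → l ≤ m + 1 → W' l = W l - η • grad W Φ (m + 1) l) :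
    frobSq (seg W' 1 (m + 1) - Φ) ≤ (1 - η / 2) * frobSq (seg W 1 (m + 1) - Φ) ∧
      Balanced W' m
        (ε + η ^ 2 * (3 * ((m : ℝ) + 1) * φ ^ 2 * frobSq (seg W 1 (m + 1) - Φ))) := by
  have hm1 : (1 : ℝ) ≤ m := by exact_mod_cast hm
  have hM0 : (0 : ℝ) < (m : ℝ) + 1 := by linarith
  set ε₀ : ℝ := 3 / (8 * ((m : ℝ) + 1) ^ 2) with hε₀
  have hε0 : 0 ≤ ε₀ := by positivity
  have hbal := h.mono hε
  have hδ : ((m : ℝ) + 1) * ε₀ = 3 / (8 * ((m : ℝ) + 1)) := by rw [hε₀]; field_simp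
  have hδm : m * (((m : ℝ) + 1) * ε₀) ≤ 3 / 8 := by
    rw [hδ, mul_div_assoc', div_le_div_iff₀ (by positivity) (by norm_num)]; linarith
  have hδ0 : 0 ≤ ((m : ℝ) + 1) * ε₀ := by positivity
  have hδ1 : ((m : ℝ) + 1) * ε₀ ≤ 3 / 8 := by nlinarith
  obtain ⟨α, hα, hαφ, hαb, hbφ⟩ := exists_layer_scale hm hφ hφm hδ0 hδ
  have hP : frob (seg W 1 (m + 1)) ≤ φ := by
    have := frob_add_le (seg W 1 (m + 1) - Φ) Φ
    rw [sub_add_cancel] at this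
    linarith
  have hL := hbal.opBound_last hε0 hm (by linarith) hα hαφ hP
  set b : ℝ := √(1 + α + ((m : ℝ) + 1) * ε₀) with hb_def
  have hb2 : b ^ 2 = 1 + α + ((m : ℝ) + 1) * ε₀ := Real.sq_sqrt (by positivity)
  have hb : 1 ≤ b := Real.one_le_sqrt.2 (by linarith)
  have hW : ∀ l, 1 ≤ l → l ≤ m → OpBound (W l) b := fun l h1 h2 =>
    hbal.opBound_of_le hε0 hα hL (zero_le_one.trans hb) hb2 h1 h2
  have hbm : (b ^ m) ^ 2 ≤ 3 * ((m : ℝ) + 1) * φ ^ 2 := by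
    rwa [← pow_mul, mul_comm m, pow_mul, hb2]
  have hab : (√α * b ^ m) ^ 2 ≤ 3 * φ ^ 2 := by
    rwa [mul_pow, Real.sq_sqrt hα, ← pow_mul, mul_comm m, pow_mul, hb2]
  have hlow : ∀ X : Matrix (Fin d) (Fin d) ℝ, 5 / 8 * frobSq X ≤ frobSq (seg W 1 m * X) := by
    refine frobSq_lower_of_transpose (by norm_num) fun X => ?_
    have h1 := hbal.lower hε0 hm (by linarith) le_rfl X
      (by rw [zero_mul]; exact frobSq_nonneg _)
    refine le_trans (mul_le_mul_of_nonneg_right ?_ (frobSq_nonneg X)) h1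
    have h2 := one_add_mul_le_pow (a := -(((m : ℝ) + 1) * ε₀)) (by linarith) m
    rw [add_zero, sub_eq_add_neg]
    linarith
  refine ⟨frobSq_gradient_step_le hη hφ hηφ hupd (Real.sqrt_nonneg α) hb hL hW hab hbm hlow hr,
    h.gradient_step hupd fun l h1 h2 => ?_⟩
  have hE := frobSq_nonneg (seg W 1 (m + 1) - Φ)
  rcases h2.eq_or_lt with rfl | h2
  · have h3 := pow_le_pow_left₀ (frob_nonneg _)
      (frob_grad_last_le Φ (zero_le_one.trans hb) hW) 2
    rw [frob_sq, mul_pow, frob_sq] at h3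
    exact h3.trans (mul_le_mul_of_nonneg_right hbm hE)
  · have h3 := pow_le_pow_left₀ (frob_nonneg _)
      (frob_grad_le Φ (Real.sqrt_nonneg α) hb hL hW h1 (Nat.lt_succ_iff.1 h2)) 2
    rw [frob_sq, mul_pow, frob_sq] at h3
    refine h3.trans (mul_le_mul_of_nonneg_right (hab.trans ?_) hE)
    nlinarith [sq_nonneg φ]

end ZAS

open ZAS
/-- Theorem 2, discrete gradient descent: with the ZAS initialization and
learning rate `η ≤ min{(4L³φ⁶)⁻¹, (144L²φ⁴)⁻¹}` where `φ = max{2‖Φ‖_F, 3L^{-1/2}, 1}`,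
gradient descent satisfies `R(t) ≤ (1 - η/2)^t R(0)`. -/
theorem discrete_gd_ZAS_convergence
    (d L : ℕ) (hd : 1 ≤ d) (hL : 2 ≤ L)
    (Φ : Matrix (Fin d) (Fin d) ℝ) (η φ : ℝ)
    (hφ : φ = max (max (2 * frob Φ) (3 / Real.sqrt L)) 1)
    (hη0 : 0 < η)
    (hη : η ≤ min (4 * (L:ℝ)^3 * φ^6)⁻¹ (144 * (L:ℝ)^2 * φ^4)⁻¹)
    (W : ℕ → ℕ → Matrix (Fin d) (Fin d) ℝ)
    (hupd : ∀ t : ℕ, ∀ l, 1 ≤ l → l ≤ L →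
      W l (t+1) = W l t - η • grad (fun k => W k t) Φ L l)
    (hinit1 : ∀ l, 1 ≤ l → l ≤ L - 1 → W l 0 = 1)
    (hinitL : W L 0 = 0)
    (t : ℕ) :
    loss (fun k => W k t) Φ L ≤ (1 - η/2)^t * loss (fun k => W k 0) Φ L := by
  obtain ⟨m, rfl⟩ : ∃ m, L = m + 1 := ⟨L - 1, by omega⟩
  rw [Nat.add_sub_cancel] at hinit1
  have hm : 1 ≤ m := by omega
  push_cast at hφ hη
  set M : ℝ := (m : ℝ) + 1 with hM
  have hM1 : 1 ≤ M := by linarith [Nat.cast_nonneg (α := ℝ) m]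
  have hM0 : 0 < M := by linarith
  have hφ1 : 1 ≤ φ := hφ ▸ le_max_right _ _
  have hφ0 : 0 < φ := by linarith
  have hΦ : frob Φ ≤ φ / 2 := by
    have : 2 * frob Φ ≤ φ := hφ ▸ (le_max_left _ _).trans (le_max_left _ _)
    linarith
  have hφM : 9 ≤ M * φ ^ 2 := by
    have h1 : 3 / √M ≤ φ := hφ ▸ (le_max_right _ _).trans (le_max_left _ _)
    rw [div_le_iff₀ (Real.sqrt_pos.2 hM0)] at h1
    have h2 := pow_le_pow_left₀ (by norm_num) h1 2
    rw [mul_pow, Real.sq_sqrt hM0.le] at h2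
    linarith
  have hηφ : η * M ^ 2 * φ ^ 4 ≤ 1 / 144 := by
    have h1 := hη.trans (min_le_right _ _)
    rw [le_inv_comm₀ hη0 (by positivity), ← one_div, le_div_iff₀ hη0] at h1
    linarith
  have hη3 : η * M ^ 3 * φ ^ 6 ≤ 1 / 4 := by
    have h1 := hη.trans (min_le_left _ _)
    rw [le_inv_comm₀ hη0 (by positivity), ← one_div, le_div_iff₀ hη0] at h1
    linarith
  have hη1 : η ≤ 1 := by
    have h1 : 1 ≤ M ^ 2 * φ ^ 4 :=
      one_le_mul_of_one_le_of_one_le (one_le_pow₀ hM1) (one_le_pow₀ hφ1)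
    nlinarith
  -- total drift of the balancedness
  set C : ℝ := 3 / 2 * η * M * φ ^ 4 with hC
  have hC0 : 0 ≤ C := by positivity
  have hCε : C ≤ 3 / (8 * M ^ 2) := by
    rw [le_div_iff₀ (by positivity)]
    calc C * (8 * M ^ 2) = 12 * (η * M ^ 3 * φ ^ 4) := by rw [hC]; ring
      _ ≤ 12 * (η * M ^ 3 * φ ^ 6) := by gcongr; norm_num
      _ ≤ 3 := by linarith
  have hE0 : frobSq (seg (fun k => W k 0) 1 (m + 1) - Φ) = frobSq Φ := by
    rw [seg_one_succ, hinitL, Matrix.zero_mul, zero_sub, ← frob_sq, frob_neg, frob_sq]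
  have hΦ2 : frobSq Φ ≤ φ ^ 2 / 4 := by
    rw [← frob_sq]
    nlinarith [frob_nonneg Φ]
  have key : ∀ t : ℕ,
      frobSq (seg (fun k => W k t) 1 (m + 1) - Φ) ≤ (1 - η / 2) ^ t * frobSq Φ ∧
      Balanced (fun k => W k t) m (C * (1 - (1 - η / 2) ^ t)) := by
    intro t
    induction t with
    | zero =>
      refine ⟨by rw [hE0, pow_zero, one_mul], fun l h1 h2 X => ?_⟩
      simp only [hinit1 l h1 h2, pow_zero, sub_self, mul_zero, zero_mul, transpose_one,
        Matrix.one_mul]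
      rcases h2.eq_or_lt with rfl | h2
      · rw [if_pos rfl, hinitL, Matrix.zero_mul]
        simp [frobSq]
      · rw [if_neg h2.ne, hinit1 (l + 1) (by omega) (by omega), Matrix.one_mul]
        simp
    | succ t ih =>
      obtain ⟨ih1, ih2⟩ := ih
      have hq0 : 0 ≤ 1 - η / 2 := by linarith
      have hqt0 : 0 ≤ (1 - η / 2) ^ t := pow_nonneg hq0 t
      have hqt1 : (1 - η / 2) ^ t ≤ 1 := pow_le_one₀ hq0 (by linarith)
      have hr : frob (seg (fun k => W k t) 1 (m + 1) - Φ) ≤ φ / 2 := by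
        apply le_of_sq_le_sq _ (by linarith)
        rw [frob_sq]
        nlinarith [frobSq_nonneg Φ]
      obtain ⟨h1, h2⟩ := ih2.descent (W' := fun k => W k (t + 1)) hm
        (by nlinarith) hη0.le hφ1 hφM hηφ hΦ hr (hupd t)
      refine ⟨?_, h2.mono ?_⟩
      · rw [pow_succ', mul_assoc]
        exact h1.trans (mul_le_mul_of_nonneg_left ih1 hq0)
      · have h3 : frobSq (seg (fun k => W k t) 1 (m + 1) - Φ)
            ≤ (1 - η / 2) ^ t * (φ ^ 2 / 4) :=
          ih1.trans (mul_le_mul_of_nonneg_left hΦ2 hqt0)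
        calc C * (1 - (1 - η / 2) ^ t) + η ^ 2 * (3 * M * φ ^ 2 *
              frobSq (seg (fun k => W k t) 1 (m + 1) - Φ))
            ≤ C * (1 - (1 - η / 2) ^ t) + η ^ 2 * (3 * M * φ ^ 2 *
              ((1 - η / 2) ^ t * (φ ^ 2 / 4))) := by gcongr
          _ = C * (1 - (1 - η / 2) ^ (t + 1)) := by rw [hC, pow_succ]; ring
  simp only [loss, hE0]
  linarith [(key t).1]
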